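/- arXiv:2307.08211 — 2 statements merged into one kernel-verified Lean document; each statement's English description precedes it below -/
import Mathlib

section
/- For every C₁ ≥ 1 there is C₂ > 0 depending only on C₁ with the following property. Let n ≥ 2, let B be an n×n complex matrix, and let (v_{i,j})_{i,j≤n} be nonnegative reals. Assume that for every choice of nonempty subsets I, J ⊆ [n] one has ‖B_{I,J}‖_{∞→2} ≤ C₁ · √( max(|I|,|J|) · log n ) · √( max_{i∈I} Σ_{j∈J} v_{i,j}² ). Then for every choice of nonempty subsets I, J ⊆ [n], ‖B_{I,J}‖_{∞→2} ≤ C₂ · max( max_{i∈I} √(Σ_{j∈J} v_{i,j}²), max_{j∈J} √(Σ_{i∈I} v_{i,j}²) ) · √|J| · (log n)^{3/2}. -/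
open Matrix

/-- Euclidean norm of a complex vector. -/
noncomputable def enorm2 {ι : Type*} [Fintype ι] (v : ι → ℂ) : ℝ :=
  Real.sqrt (∑ i, ‖v i‖ ^ 2)

/-- The `∞→2` norm of a rectangular complex matrix: the supremum of `‖Mx‖₂` over vectors `x`
with `‖x‖_∞ ≤ 1`. -/
noncomputable def normInfTwo {ι₁ ι₂ : Type*} [Fintype ι₁] [Fintype ι₂]
    (M : Matrix ι₁ ι₂ ℂ) : ℝ :=
  sSup { r : ℝ | ∃ x : ι₂ → ℂ, (∀ j, ‖x j‖ ≤ 1) ∧ r = enorm2 (M.mulVec x) }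

/-- Each value `enorm2 (M x)` with `‖x‖_∞ ≤ 1` is at most the `∞→2` norm. -/
lemma enorm2_mulVec_le_normInfTwo {ι₁ ι₂ : Type*} [Fintype ι₁] [Fintype ι₂]
    (M : Matrix ι₁ ι₂ ℂ) (x : ι₂ → ℂ) (hx : ∀ j, ‖x j‖ ≤ 1) :
    enorm2 (M.mulVec x) ≤ normInfTwo M := by
  refine le_csSup ⟨Real.sqrt (∑ i, (∑ j, ‖M i j‖) ^ 2), ?_⟩ ⟨x, hx, rfl⟩
  rintro _ ⟨z, hz, rfl⟩
  refine Real.sqrt_le_sqrt (Finset.sum_le_sum fun i _ => ?_)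
  refine pow_le_pow_left₀ (norm_nonneg _) ?_ 2
  refine (norm_sum_le _ _).trans (Finset.sum_le_sum fun j _ => ?_)
  rw [norm_mul]
  exact mul_le_of_le_one_right (norm_nonneg _) (hz j)

/-- Dyadic decomposition of an index set `I` according to the size of the weights `r`. -/
lemma sum_le_dyadic_add_tail {ι : Type*} (I : Finset ι) (f r : ι → ℝ) {c m S : ℝ}
    (hc : 0 ≤ c) (hm : 0 ≤ m) (hS : 0 ≤ S) (hr : ∀ i ∈ I, 0 ≤ r i) (hrS : ∀ i ∈ I, r i ≤ S)
    (hsum : ∑ i ∈ I, r i ≤ m * S)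
    (hf : ∀ T ⊆ I, ∀ t, 0 ≤ t → (∀ i ∈ T, r i ≤ t) → ∑ i ∈ T, f i ≤ c * (max (T.card : ℝ) m * t))
    (K : ℕ) :
    ∑ i ∈ I, f i ≤ K * (c * (2 * (m * S))) + ∑ i ∈ I with r i ≤ S / 2 ^ K, f i := by
  induction K with
  | zero =>
    rw [Finset.filter_true_of_mem (by simpa using hrS)]
    simp
  | succ K ih =>
    set A := I.filter fun i => r i ≤ S / 2 ^ K with hA
    have hAI : A ⊆ I := Finset.filter_subset _ _
    have hhalf : S / 2 ^ (K + 1) ≤ S / 2 ^ K :=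
      div_le_div_of_nonneg_left hS (by positivity) (pow_le_pow_right₀ (by norm_num) K.le_succ)
    have htail : (A.filter fun i => r i ≤ S / 2 ^ (K + 1)) =
        I.filter fun i => r i ≤ S / 2 ^ (K + 1) := by
      ext i
      simp only [hA, Finset.mem_filter]
      exact ⟨fun h => ⟨h.1.1, h.2⟩, fun h => ⟨⟨h.1, h.2.trans hhalf⟩, h.2⟩⟩
    set T := A.filter fun i => ¬ r i ≤ S / 2 ^ (K + 1)
    have hTA : T ⊆ A := Finset.filter_subset _ _
    have hcard : (T.card : ℝ) * (S / 2 ^ (K + 1)) ≤ m * S := by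
      rw [← nsmul_eq_mul]
      refine (Finset.card_nsmul_le_sum T r _ fun i hi => ?_).trans
        ((Finset.sum_le_sum_of_subset_of_nonneg (hTA.trans hAI) fun i hi _ => hr i hi).trans hsum)
      exact (not_le.mp (Finset.mem_filter.mp hi).2).le
    have hmax : max (T.card : ℝ) m * (S / 2 ^ K) ≤ 2 * (m * S) := by
      rw [max_mul_of_nonneg _ _ (by positivity)]
      refine max_le ?_ ?_
      · have : S / 2 ^ K = 2 * (S / 2 ^ (K + 1)) := by
          rw [pow_succ]; field_simp
        rw [this]; linarith
      · have : S / 2 ^ K ≤ S := div_le_self hS (one_le_pow₀ (by norm_num))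
        nlinarith [mul_le_mul_of_nonneg_left this hm, mul_nonneg hm hS]
    have hpiece : ∑ i ∈ T, f i ≤ c * (2 * (m * S)) :=
      (hf T (hTA.trans hAI) (S / 2 ^ K) (by positivity)
        fun i hi => (Finset.mem_filter.mp (hTA hi)).2).trans (mul_le_mul_of_nonneg_left hmax hc)
    have hsplit := Finset.sum_filter_add_sum_filter_not A (fun i => r i ≤ S / 2 ^ (K + 1)) f
    rw [htail] at hsplit
    push_cast
    linarith

/-- If every sum of `f` over a subset `T` of `I` is controlled by `max |T| m` times the largest
weight in `T`, the sum over `I` is controlled by `m` up to a logarithmic factor in `n ≥ |I|`. -/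
lemma sum_le_log_mul {ι : Type*} (I : Finset ι) (f r : ι → ℝ) {c m S : ℝ} {n : ℕ}
    (hn : 2 ≤ n) (hIn : I.card ≤ n) (hmn : m ≤ n)
    (hc : 0 ≤ c) (hm : 1 ≤ m) (hS : 0 ≤ S) (hr : ∀ i ∈ I, 0 ≤ r i) (hrS : ∀ i ∈ I, r i ≤ S)
    (hsum : ∑ i ∈ I, r i ≤ m * S)
    (hf : ∀ T ⊆ I, ∀ t, 0 ≤ t → (∀ i ∈ T, r i ≤ t) →
      ∑ i ∈ T, f i ≤ c * (max (T.card : ℝ) m * t)) :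
    ∑ i ∈ I, f i ≤ 12 * Real.log n * (c * (m * S)) := by
  set K := Nat.log 2 n + 1 with hK
  have hmS : 0 ≤ m * S := mul_nonneg (by linarith) hS
  have hdyadic := sum_le_dyadic_add_tail I f r hc (by linarith) hS hr hrS hsum hf K
  have hpow : (n : ℝ) ≤ 2 ^ K := by
    exact_mod_cast (Nat.lt_pow_succ_log_self (by norm_num) n).le
  have htail : ∑ i ∈ I with r i ≤ S / 2 ^ K, f i ≤ c * (2 * (m * S)) := by
    refine (hf _ (Finset.filter_subset _ _) (S / 2 ^ K) (by positivity)
      fun i hi => (Finset.mem_filter.mp hi).2).trans (mul_le_mul_of_nonneg_left ?_ hc)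
    have hle : max ((I.filter fun i => r i ≤ S / 2 ^ K).card : ℝ) m ≤ 2 ^ K :=
      (max_le (by exact_mod_cast (Finset.card_filter_le _ _).trans hIn) hmn).trans hpow
    calc _ ≤ 2 ^ K * (S / 2 ^ K) := mul_le_mul_of_nonneg_right hle (by positivity)
      _ = S := by field_simp
      _ ≤ 2 * (m * S) := by nlinarith
  have hlog2 : (1 : ℝ) / 2 ≤ Real.log 2 := by linarith [Real.log_two_gt_d9]
  have hL : Real.log 2 ≤ Real.log n := Real.log_le_log (by norm_num) (by exact_mod_cast hn)
  have hlog : (Nat.log 2 n : ℝ) * Real.log 2 ≤ Real.log n := by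
    rw [← Real.log_pow]
    exact Real.log_le_log (by positivity) (by exact_mod_cast Nat.pow_log_le_self 2 (by omega))
  have hK' : (K : ℝ) + 1 ≤ 6 * Real.log n := by
    rw [hK]
    push_cast
    nlinarith [mul_le_mul_of_nonneg_left hlog2 (Nat.cast_nonneg (α := ℝ) (Nat.log 2 n))]
  have hcmS : 0 ≤ c * (2 * (m * S)) := by positivity
  linarith [mul_le_mul_of_nonneg_right hK' hcmS]

/-- For every `C₁ ≥ 1` there is `C₂ > 0` with the following property: let
`n ≥ 2`, `B` an `n×n` complex matrix, `(v_{ij})` nonnegative reals with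
`‖B_{I,J}‖_{HS}² ≤ Σ_{i∈I,j∈J} v_{ij}²` and
`‖B_{I,J}‖_{∞→2} ≤ C₁ √(max(|I|,|J|) log n) √(max_{i∈I} Σ_{j∈J} v_{ij}²)`
for all nonempty `I, J ⊆ [n]`. Then for all nonempty `I, J ⊆ [n]`:
`‖B_{I,J}‖_{∞→2} ≤ C₂ max(max_{i∈I} √(Σ_{j∈J} v_{ij}²), max_{j∈J} √(Σ_{i∈I} v_{ij}²)) √|J| (log n)^{3/2}`. -/
theorem infty_two_norm_improved_bound (C₁ : ℝ) (hC₁ : 1 ≤ C₁) :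
    ∃ C₂ : ℝ, 0 < C₂ ∧
    ∀ (n : ℕ), 2 ≤ n →
    ∀ (B : Matrix (Fin n) (Fin n) ℂ) (v : Fin n → Fin n → ℝ),
      (∀ i j, 0 ≤ v i j) →
      -- Hilbert–Schmidt norms of submatrices are dominated by the profile
      (∀ (I J : Finset (Fin n)), I.Nonempty → J.Nonempty →
        ∑ i ∈ I, ∑ j ∈ J, ‖B i j‖ ^ 2 ≤ ∑ i ∈ I, ∑ j ∈ J, v i j ^ 2) →
      -- the `∞→2` norm hypothesis
      (∀ (I J : Finset (Fin n)) (hI : I.Nonempty) (_hJ : J.Nonempty),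
        normInfTwo (B.submatrix (Subtype.val : I → Fin n) (Subtype.val : J → Fin n))
          ≤ C₁ * Real.sqrt ((max I.card J.card : ℕ) * Real.log n)
            * Real.sqrt (I.sup' hI fun i => ∑ j ∈ J, v i j ^ 2)) →
      ∀ (I J : Finset (Fin n)) (hI : I.Nonempty) (hJ : J.Nonempty),
        normInfTwo (B.submatrix (Subtype.val : I → Fin n) (Subtype.val : J → Fin n))
          ≤ C₂ * max
              (I.sup' hI fun i => Real.sqrt (∑ j ∈ J, v i j ^ 2))
              (J.sup' hJ fun j => Real.sqrt (∑ i ∈ I, v i j ^ 2))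
            * Real.sqrt J.card * Real.log n ^ ((3 : ℝ) / 2) := by
  refine ⟨5 * C₁, by linarith, ?_⟩
  intro n hn B v _ _ hB I J hI hJ
  set M := max (I.sup' hI fun i => Real.sqrt (∑ j ∈ J, v i j ^ 2))
    (J.sup' hJ fun j => Real.sqrt (∑ i ∈ I, v i j ^ 2))
  set L := Real.log n with hLdef
  have hL : 1 / 2 ≤ L := by
    have : Real.log 2 ≤ L := Real.log_le_log (by norm_num) (by exact_mod_cast hn)
    linarith [Real.log_two_gt_d9]
  have hrow : ∀ i ∈ I, Real.sqrt (∑ j ∈ J, v i j ^ 2) ≤ M := fun i hi =>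
    (Finset.le_sup' (fun i => Real.sqrt (∑ j ∈ J, v i j ^ 2)) hi).trans (le_max_left _ _)
  have hcol : ∀ j ∈ J, Real.sqrt (∑ i ∈ I, v i j ^ 2) ≤ M := fun j hj =>
    (Finset.le_sup' (fun j => Real.sqrt (∑ i ∈ I, v i j ^ 2)) hj).trans (le_max_right _ _)
  have hM0 : 0 ≤ M := (Real.sqrt_nonneg _).trans (hrow _ hI.choose_spec)
  have hJ1 : (1 : ℝ) ≤ J.card := by exact_mod_cast hJ.card_pos
  refine Real.sSup_le ?_ (by positivity)
  rintro _ ⟨x, hx, rfl⟩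
  have hf : ∀ T ⊆ I, ∀ t : ℝ, 0 ≤ t → (∀ i ∈ T, ∑ j ∈ J, v i j ^ 2 ≤ t) →
      ∑ i ∈ T, ‖∑ j : J, B i j * x j‖ ^ 2 ≤
        C₁ ^ 2 * L * (max (T.card : ℝ) J.card * t) := by
    intro T _ t ht hTt
    rcases T.eq_empty_or_nonempty with rfl | hT
    · simp only [Finset.sum_empty]
      positivity
    have h := (enorm2_mulVec_le_normInfTwo
      (B.submatrix (Subtype.val : T → Fin n) (Subtype.val : J → Fin n)) x hx).trans (hB T J hT hJ)
    have h' := h.trans (mul_le_mul_of_nonneg_left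
      (Real.sqrt_le_sqrt (Finset.sup'_le hT (fun i => ∑ j ∈ J, v i j ^ 2) hTt)) (by positivity))
    have hsq := pow_le_pow_left₀ (Real.sqrt_nonneg _) h' 2
    rw [Real.sq_sqrt (by positivity), mul_pow, mul_pow, Real.sq_sqrt (by positivity),
      Real.sq_sqrt ht, Nat.cast_max] at hsq
    rw [← Finset.sum_coe_sort T]
    calc _ ≤ _ := hsq
      _ = _ := by ring
  have hsum : ∑ i ∈ I, ∑ j ∈ J, v i j ^ 2 ≤ J.card * M ^ 2 := by
    rw [Finset.sum_comm, ← nsmul_eq_mul]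
    exact Finset.sum_le_card_nsmul _ _ _ fun j hj => (Real.sqrt_le_left hM0).mp (hcol j hj)
  have hmain := sum_le_log_mul I (fun i => ‖∑ j : J, B i j * x j‖ ^ 2)
    (fun i => ∑ j ∈ J, v i j ^ 2) hn (by simpa using I.card_le_univ)
    (by exact_mod_cast (by simpa using J.card_le_univ : J.card ≤ n)) (by positivity) hJ1
    (sq_nonneg M) (fun i _ => by positivity)
    (fun i hi => (Real.sqrt_le_left hM0).mp (hrow i hi)) hsum hf
  refine Real.sqrt_le_iff.mpr ⟨by positivity, ?_⟩
  have hpow : (L ^ ((3 : ℝ) / 2)) ^ 2 = L ^ 3 := by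
    rw [← Real.rpow_natCast, ← Real.rpow_mul (by linarith), ← Real.rpow_natCast]
    norm_num
  rw [mul_pow, mul_pow, mul_pow, hpow, Real.sq_sqrt (by positivity)]
  refine le_trans (le_of_eq ?_) (hmain.trans ?_)
  · exact Finset.sum_coe_sort I fun i => ‖∑ j : J, B i j * x j‖ ^ 2
  · have hD : 0 ≤ C₁ ^ 2 * M ^ 2 * J.card * L ^ 2 := by positivity
    rw [← hLdef]
    nlinarith [mul_le_mul_of_nonneg_left hL hD]
end

section
/- Let n ≥ m ≥ 1, κ ∈ (0,1], r > 0, and let (v_{i,j})_{i,j≤m} be nonnegative reals satisfying Σ_{i=1}^m v_{i,j}² ≤ n^{−2κ}·r² for every j ≤ m. Then there exists a permutation π of [m] and a partition of [m] into k consecutive intervals (blocks) with k ≤ 1/κ + 1 such that, writing x_{i,j} := v_{π(i),π(j)}, for every pair of block indices 1 ≤ j ≤ i ≤ k and every row index p lying in the i-th block, one has Σ_{q in the j-th block} x_{p,q}² ≤ n^{−κ}·r². -/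
/-- Starting from all indices, each step keeps the rows whose sum over the previously kept
columns exceeds `θ`. -/
noncomputable def heavyRows {ι : Type*} [Fintype ι] (w : ι → ι → ℝ) (θ : ℝ) : ℕ → Finset ι
  | 0 => Finset.univ
  | t + 1 => (heavyRows w θ t).filter fun p => θ < ∑ q ∈ heavyRows w θ t, w p q

theorem heavyRows_antitone {ι : Type*} [Fintype ι] (w : ι → ι → ℝ) (θ : ℝ) :
    Antitone (heavyRows w θ) :=
  antitone_nat_of_succ_le fun t => by
    rw [heavyRows]
    exact Finset.filter_subset _ _

theorem sum_le_of_notMem_heavyRows_succ {ι : Type*} [Fintype ι] {w : ι → ι → ℝ} {θ : ℝ}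
    {t : ℕ} {p : ι} (hp : p ∈ heavyRows w θ t) (hp' : p ∉ heavyRows w θ (t + 1)) :
    ∑ q ∈ heavyRows w θ t, w p q ≤ θ := by
  rw [heavyRows, Finset.mem_filter] at hp'
  exact not_lt.mp fun h => hp' ⟨hp, h⟩

/-- Double counting: if all column sums are at most `δ`, the rows that are heavy on the columns
in `heavyRows w θ t` are few. -/
theorem card_heavyRows_succ_mul_lt {ι : Type*} [Fintype ι] {w : ι → ι → ℝ} {θ δ : ℝ}
    (hw : ∀ i j, 0 ≤ w i j) (hcol : ∀ j, ∑ i, w i j ≤ δ) {t : ℕ}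
    (hne : (heavyRows w θ (t + 1)).Nonempty) :
    ((heavyRows w θ (t + 1)).card : ℝ) * θ < (heavyRows w θ t).card * δ := by
  calc ((heavyRows w θ (t + 1)).card : ℝ) * θ = ∑ _p ∈ heavyRows w θ (t + 1), θ := by simp
    _ < ∑ p ∈ heavyRows w θ (t + 1), ∑ q ∈ heavyRows w θ t, w p q := by
        refine Finset.sum_lt_sum_of_nonempty hne fun p hp => ?_
        rw [heavyRows, Finset.mem_filter] at hp
        exact hp.2
    _ = ∑ q ∈ heavyRows w θ t, ∑ p ∈ heavyRows w θ (t + 1), w p q := Finset.sum_comm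
    _ ≤ ∑ _q ∈ heavyRows w θ t, δ := by
        refine Finset.sum_le_sum fun q _ => le_trans ?_ (hcol q)
        exact Finset.sum_le_univ_sum_of_nonneg fun p => hw p q
    _ = (heavyRows w θ t).card * δ := by simp

theorem card_heavyRows_succ_lt_pow {ι : Type*} [Fintype ι] {w : ι → ι → ℝ} {θ ε : ℝ}
    (hw : ∀ i j, 0 ≤ w i j) (hθ : 0 < θ) (hε : 0 < ε) (hcol : ∀ j, ∑ i, w i j ≤ ε * θ) (t : ℕ)
    (hne : (heavyRows w θ (t + 1)).Nonempty) :
    ((heavyRows w θ (t + 1)).card : ℝ) < ε ^ (t + 1) * Fintype.card ι := by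
  have step : ∀ s, (heavyRows w θ (s + 1)).Nonempty →
      ((heavyRows w θ (s + 1)).card : ℝ) < ε * (heavyRows w θ s).card := by
    intro s hs
    have := card_heavyRows_succ_mul_lt hw hcol hs
    rw [← mul_assoc, mul_comm _ ε] at this
    exact lt_of_mul_lt_mul_right this hθ.le
  induction t with
  | zero => simpa [heavyRows] using step 0 hne
  | succ t ih =>
    have hne' := hne.mono (heavyRows_antitone w θ (Nat.le_succ (t + 1)))
    calc ((heavyRows w θ (t + 1 + 1)).card : ℝ) < ε * (heavyRows w θ (t + 1)).card := step _ hne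
      _ ≤ ε * (ε ^ (t + 1) * Fintype.card ι) := by gcongr; exact (ih hne').le
      _ = ε ^ (t + 1 + 1) * Fintype.card ι := by ring

/-- A finite chain of subsets of `Fin m` is carried to a chain of initial segments by some
permutation. -/
theorem exists_perm_mem_iff_lt_card {m : ℕ} {T : ℕ → Finset (Fin m)} (hT : Monotone T) (k : ℕ) :
    ∃ π : Equiv.Perm (Fin m), ∀ i ≤ k, ∀ p : Fin m, π p ∈ T i ↔ (p : ℕ) < (T i).card := by
  let f : Fin m → ℕ := fun p => ((Finset.range (k + 1)).filter fun i => p ∉ T i).card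
  have hf : ∀ i ≤ k, ∀ p, f p ≤ i ↔ p ∈ T i := by
    intro i hi p
    constructor
    · intro h
      by_contra hp
      have hsub : Finset.range (i + 1) ⊆ (Finset.range (k + 1)).filter fun i => p ∉ T i := by
        intro a ha
        rw [Finset.mem_range] at ha
        rw [Finset.mem_filter, Finset.mem_range]
        exact ⟨by omega, fun h' => hp (hT (by omega) h')⟩
      have := Finset.card_le_card hsub
      rw [Finset.card_range] at this
      exact absurd (this.trans h) (by omega)
    · intro hp
      have hsub : ((Finset.range (k + 1)).filter fun i => p ∉ T i) ⊆ Finset.range i := by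
        intro a ha
        rw [Finset.mem_filter] at ha
        rw [Finset.mem_range]
        by_contra hia
        exact ha.2 (hT (by omega) hp)
      simpa using Finset.card_le_card hsub
  refine ⟨Tuple.sort f, fun i hi p => ?_⟩
  have hcard : (Finset.univ.filter fun q => (f ∘ Tuple.sort f) q ≤ i).card = (T i).card :=
    Finset.card_equiv (Tuple.sort f) fun q => by simp [hf i hi]
  rw [← hf i hi, ← hcard]
  exact (Tuple.lt_card_le_iff_apply_le_of_monotone (Tuple.monotone_sort f)).symm

/-- (Block decomposition of a variance profile.) Let `n ≥ m ≥ 1`,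
`κ ∈ (0,1]`, `r > 0`, and let `(v_{ij})` be nonnegative reals with
`Σ_i v_{ij}² ≤ n^{−2κ} r²` for every `j`. Then there is a permutation `π` of `[m]` and a
partition of `[m]` into `k ≤ 1/κ + 1` consecutive intervals, given by boundaries
`0 = c 0 ≤ c 1 ≤ … ≤ c k = m` (the `ℓ`-th block consisting of indices `p` with
`c ℓ ≤ p < c (ℓ+1)`), such that for all block indices `j ≤ i` and every `p` in the `i`-th
block, `Σ_{q ∈ j-th block} v_{π p, π q}² ≤ n^{−κ} r²`. -/
theorem variance_profile_block_decomposition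
    (n m : ℕ) (hm : 1 ≤ m) (hnm : m ≤ n) (κ : ℝ) (hκ : 0 < κ) (hκ1 : κ ≤ 1)
    (r : ℝ) (hr : 0 < r) (v : Fin m → Fin m → ℝ) (hv : ∀ i j, 0 ≤ v i j)
    (hcol : ∀ j : Fin m, ∑ i : Fin m, v i j ^ 2 ≤ (n : ℝ) ^ (-(2 * κ)) * r ^ 2) :
    ∃ (π : Equiv.Perm (Fin m)) (k : ℕ), 1 ≤ k ∧ (k : ℝ) ≤ 1 / κ + 1 ∧
    ∃ c : Fin (k + 1) → ℕ, Monotone c ∧ c 0 = 0 ∧ c (Fin.last k) = m ∧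
      ∀ i j : Fin k, j ≤ i →
        ∀ p : Fin m, c i.castSucc ≤ (p : ℕ) → (p : ℕ) < c i.succ →
          ∑ q ∈ Finset.univ.filter
              (fun q : Fin m => c j.castSucc ≤ (q : ℕ) ∧ (q : ℕ) < c j.succ),
            v (π p) (π q) ^ 2 ≤ (n : ℝ) ^ (-κ) * r ^ 2 := by
  have hn : (1 : ℝ) ≤ n := by exact_mod_cast hm.trans hnm
  have hn0 : (0 : ℝ) < n := by linarith
  set ε : ℝ := (n : ℝ) ^ (-κ) with hεdef
  have hε : 0 < ε := Real.rpow_pos_of_pos hn0 _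
  have hθ : 0 < ε * r ^ 2 := by positivity
  let S := heavyRows (fun i j => v i j ^ 2) (ε * r ^ 2)
  have hcol' : ∀ j, ∑ i, v i j ^ 2 ≤ ε * (ε * r ^ 2) := fun j => by
    refine (hcol j).trans_eq ?_
    rw [← mul_assoc, hεdef, ← Real.rpow_add hn0]
    ring_nf
  set k := ⌊1 / κ⌋₊ + 1 with hk
  have hkκ : 1 ≤ κ * k := by
    have := Nat.lt_floor_add_one (1 / κ)
    rw [div_lt_iff₀ hκ] at this
    rw [hk]
    push_cast
    linarith
  have hempty : S k = ∅ := by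
    by_contra hne
    rw [← ne_eq, ← Finset.nonempty_iff_ne_empty] at hne
    have hlt := card_heavyRows_succ_lt_pow (fun i j => sq_nonneg (v i j)) hθ hε hcol' _ hne
    have hpow : ε ^ k * (m : ℝ) ≤ 1 := by
      calc ε ^ k * (m : ℝ) ≤ ε ^ k * n := by gcongr
        _ = (n : ℝ) ^ (-κ * k + 1) := by
          rw [Real.rpow_add hn0, Real.rpow_one, Real.rpow_mul hn0.le, Real.rpow_natCast]
        _ ≤ 1 := Real.rpow_le_one_of_one_le_of_nonpos hn (by linarith)
    have hone : (1 : ℝ) ≤ (S k).card := by exact_mod_cast hne.card_pos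
    rw [Fintype.card_fin] at hlt
    exact absurd (hone.trans_lt (hlt.trans_le hpow)) (lt_irrefl _)
  have hS : Antitone S := heavyRows_antitone _ _
  have hT : Monotone fun i => S (k - i) := fun a b hab => hS (by omega)
  obtain ⟨π, hπ⟩ := exists_perm_mem_iff_lt_card hT k
  refine ⟨π, k, by omega, ?_, fun i => (S (k - i)).card, ?_, ?_, ?_, ?_⟩
  · rw [hk]
    push_cast
    gcongr
    exact Nat.floor_le (by positivity)
  · exact fun a b hab => Finset.card_le_card (hT hab)
  · simp [hempty]
  · simp [S, heavyRows]
  · intro i j hji p hp hp'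
    have hi := i.is_lt
    have hji' : (j : ℕ) ≤ i := hji
    simp only [Fin.val_castSucc, Fin.val_succ] at hp hp' ⊢
    have hmem : π p ∈ S (k - (i + 1)) := (hπ (i + 1) (by omega) p).2 hp'
    have hnot : π p ∉ S (k - (i + 1) + 1) := by
      rw [show k - ((i : ℕ) + 1) + 1 = k - i by omega]
      exact fun h => absurd ((hπ i (by omega) p).1 h) (not_lt.mpr hp)
    refine le_trans ?_ (sum_le_of_notMem_heavyRows_succ hmem hnot)
    refine (Finset.sum_map _ π.toEmbedding fun q => v (π p) q ^ 2).symm.trans_le ?_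
    refine Finset.sum_le_sum_of_subset_of_nonneg ?_ fun q _ _ => sq_nonneg _
    intro q hq
    obtain ⟨a, ha, rfl⟩ := Finset.mem_map.mp hq
    exact hT (show (j : ℕ) + 1 ≤ i + 1 by omega)
      ((hπ (j + 1) (by omega) a).2 (Finset.mem_filter.mp ha).2.2)
end
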